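/- Let δ > 0 and define B₊, B₋, φ₊, φ₋ as follows: B₊(x) = (2 sin²(πx)/π²)·[Σ_{k=0}^∞ 1/(x−k)² + 1/x] − 1, B₋(x) = (2 sin²(πx)/π²)·[Σ_{k=1}^∞ 1/(x−k)² + 1/x] − 1 (each extended continuously across its removable singularities), φ₊(x) = ½ B₊(δ+x) + ½ B₊(δ−x), φ₋(x) = ½ B₋(δ+x) + ½ B₋(δ−x). Then φ₊ and φ₋ are Lebesgue integrable on ℝ and their Fourier transforms φ̂±(t) = ∫_ℝ φ±(x) e^{−itx} dx vanish for all t ∈ ℝ with |t| > 2π; that is, φ₊ and φ₋ are band-limited with Fourier support contained in [−2π, 2π]. -/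

import Mathlib

open Classical in
/-- The Beurling–Selberg majorant building block
`B₊(x) = (2 sin²(πx)/π²)(Σ_{k=0}^∞ 1/(x-k)² + 1/x) - 1`, extended continuously across the
removable singularities at the nonnegative integers (where its value is `1`). -/
noncomputable def Bplus (x : ℝ) : ℝ :=
  if ∃ n : ℕ, x = (n : ℝ) then 1
  else 2 * Real.sin (Real.pi * x) ^ 2 / Real.pi ^ 2 *
    ((∑' k : ℕ, 1 / (x - (k : ℝ)) ^ 2) + 1 / x) - 1

open Classical in
/-- The Beurling–Selberg minorant building block
`B₋(x) = (2 sin²(πx)/π²)(Σ_{k=1}^∞ 1/(x-k)² + 1/x) - 1`, extended continuously across the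
removable singularities at the positive integers (where its value is `1`); at `x = 0` the
formula itself is continuous with value `-1` (in Lean `1/0 = 0`). -/
noncomputable def Bminus (x : ℝ) : ℝ :=
  if ∃ n : ℕ, 0 < n ∧ x = (n : ℝ) then 1
  else 2 * Real.sin (Real.pi * x) ^ 2 / Real.pi ^ 2 *
    ((∑' k : ℕ, 1 / (x - ((k : ℝ) + 1)) ^ 2) + 1 / x) - 1

/-- The Beurling–Selberg majorant `φ₊(x) = ½ B₊(δ+x) + ½ B₊(δ-x)` of `1_{[-δ,δ]}`. -/
noncomputable def phiPlus (δ x : ℝ) : ℝ := Bplus (δ + x) / 2 + Bplus (δ - x) / 2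

/-- The Beurling–Selberg minorant `φ₋(x) = ½ B₋(δ+x) + ½ B₋(δ-x)` of `1_{(-δ,δ)}`. -/
noncomputable def phiMinus (δ x : ℝ) : ℝ := Bminus (δ + x) / 2 + Bminus (δ - x) / 2

section Bandlimited

open MeasureTheory Filter Topology

/-- The Fejér kernel `(sin(πx)/(πx))²` (with value `0` instead of `1` at the origin). -/
noncomputable def fejerKernel (x : ℝ) : ℝ := (Real.sin (Real.pi * x) / (Real.pi * x)) ^ 2

theorem measurable_fejerKernel : Measurable fejerKernel := by
  unfold fejerKernel
  fun_prop

theorem fejerKernel_nonneg (x : ℝ) : 0 ≤ fejerKernel x := sq_nonneg _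

theorem fejerKernel_neg (x : ℝ) : fejerKernel (-x) = fejerKernel x := by
  simp [fejerKernel]

theorem fejerKernel_le_one (x : ℝ) : fejerKernel x ≤ 1 := by
  unfold fejerKernel
  rw [sq_le_one_iff_abs_le_one, abs_div]
  exact div_le_one_of_le₀ Real.abs_sin_le_abs (abs_nonneg _)

theorem fejerKernel_le_one_div_sq (x : ℝ) : fejerKernel x ≤ 1 / x ^ 2 := by
  unfold fejerKernel
  rw [div_pow, mul_pow]
  rcases eq_or_ne x 0 with rfl | hx
  · simp
  have h1 := Real.sin_sq_le_one (Real.pi * x)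
  have h2 : 0 < x ^ 2 := by positivity
  have h3 : 1 ≤ Real.pi ^ 2 := one_le_pow₀ (by linarith [Real.pi_gt_three])
  gcongr
  nlinarith

theorem sin_sq_pi_mul_sub_int (x : ℝ) (n : ℤ) :
    Real.sin (Real.pi * (x - n)) ^ 2 = Real.sin (Real.pi * x) ^ 2 := by
  rw [mul_sub, mul_comm Real.pi (n : ℝ), Real.sin_sub_int_mul_pi, mul_pow, ← zpow_natCast,
    ← zpow_mul, mul_comm n, zpow_mul]
  simp

theorem fejerKernel_sub_int (x : ℝ) (n : ℤ) :
    fejerKernel (x - n) = Real.sin (Real.pi * x) ^ 2 / Real.pi ^ 2 * (1 / (x - n) ^ 2) := by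
  rw [fejerKernel, div_pow, mul_pow, sin_sq_pi_mul_sub_int, div_mul_div_comm, mul_one]

theorem norm_sq_fourierCoeffOn_exp {x : ℝ} {n : ℤ} (hx : x ≠ n) :
    ‖fourierCoeffOn (zero_lt_one' ℝ)
      (fun t : ℝ => Complex.exp (Complex.I * ((2 * Real.pi * x * t : ℝ) : ℂ))) n‖ ^ 2 =
      fejerKernel (x - n) := by
  have hxn : x - n ≠ 0 := sub_ne_zero.2 hx
  have hc : Complex.I * ((2 * Real.pi * (x - n) : ℝ) : ℂ) ≠ 0 := by
    refine mul_ne_zero Complex.I_ne_zero (Complex.ofReal_ne_zero.2 ?_)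
    have := Real.pi_ne_zero
    positivity
  have key : fourierCoeffOn (zero_lt_one' ℝ)
      (fun t : ℝ => Complex.exp (Complex.I * ((2 * Real.pi * x * t : ℝ) : ℂ))) n =
      (Complex.exp (Complex.I * ((2 * Real.pi * (x - n) : ℝ) : ℂ)) - 1) /
        (Complex.I * ((2 * Real.pi * (x - n) : ℝ) : ℂ)) := by
    rw [fourierCoeffOn_eq_integral]
    have : ∀ t : ℝ, (fourier (-n) (t : AddCircle ((1 : ℝ) - 0))) •
        Complex.exp (Complex.I * ((2 * Real.pi * x * t : ℝ) : ℂ)) =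
        Complex.exp (Complex.I * ((2 * Real.pi * (x - n) : ℝ) : ℂ) * (t : ℂ)) := by
      intro t
      rw [fourier_coe_apply, smul_eq_mul, ← Complex.exp_add]
      congr 1
      push_cast
      ring
    simp_rw [this]
    rw [integral_exp_mul_complex hc]
    simp
  rw [key, norm_div, Complex.norm_exp_I_mul_ofReal_sub_one, norm_mul Complex.I,
    Complex.norm_I, one_mul, Complex.norm_real, fejerKernel, ← norm_div, Real.norm_eq_abs, sq_abs]
  congr 1
  rw [show 2 * Real.pi * (x - n) / 2 = Real.pi * (x - n) by ring, mul_assoc,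
    mul_div_mul_left _ _ two_ne_zero]

theorem hasSum_fejerKernel_sub_int {x : ℝ} (hx : ∀ n : ℤ, x ≠ n) :
    HasSum (fun n : ℤ => fejerKernel (x - n)) 1 := by
  have hcont : Continuous fun t : ℝ =>
      Complex.exp (Complex.I * ((2 * Real.pi * x * t : ℝ) : ℂ)) := by fun_prop
  have hmem : MemLp (fun t : ℝ => Complex.exp (Complex.I * ((2 * Real.pi * x * t : ℝ) : ℂ))) 2
      (volume.restrict (Set.Ioc 0 1)) :=
    MemLp.of_bound hcont.aestronglyMeasurable 1
      (.of_forall fun t => by rw [mul_comm, Complex.norm_exp_ofReal_mul_I])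
  have h := hasSum_sq_fourierCoeffOn (zero_lt_one' ℝ) hmem
  simp_rw [norm_sq_fourierCoeffOn_exp (hx _)] at h
  convert h
  have : ∀ t : ℝ, ‖Complex.exp (Complex.I * ((2 * Real.pi * x * t : ℝ) : ℂ))‖ = 1 := fun t => by
    rw [mul_comm, Complex.norm_exp_ofReal_mul_I]
  simp_rw [this]
  simp

theorem hasSum_inv_mul_succ {y : ℝ} (hy : 0 < y) :
    HasSum (fun k : ℕ => 1 / (y + k) - 1 / (y + (k + 1))) (1 / y) := by
  have hlim : Tendsto (fun k : ℕ => 1 / (y + (k : ℝ))) atTop (𝓝 0) :=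
    tendsto_const_nhds.div_atTop (tendsto_atTop_add_const_left _ _ tendsto_natCast_atTop_atTop)
  rw [hasSum_iff_tendsto_nat_of_nonneg]
  · have : ∀ n : ℕ, ∑ k ∈ Finset.range n, (1 / (y + k) - 1 / (y + (k + 1))) =
        1 / y - 1 / (y + n) := fun n => by
      simpa using Finset.sum_range_sub' (fun k : ℕ => 1 / (y + (k : ℝ))) n
    simp_rw [this]
    simpa using hlim.const_sub (1 / y)
  · intro k
    have : 0 < y + k := by positivity
    rw [sub_nonneg]
    gcongr
    linarith

theorem summable_one_div_add_sq {y : ℝ} (hy : 0 < y) :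
    Summable fun k : ℕ => 1 / (y + k) ^ 2 := by
  rw [← summable_nat_add_iff 1]
  refine (hasSum_inv_mul_succ hy).summable.of_nonneg_of_le (fun k => by positivity) fun k => ?_
  have : 0 < y + k := by positivity
  rw [div_sub_div _ _ (by positivity) (by positivity)]
  push_cast
  rw [div_le_div_iff₀ (by positivity) (by positivity)]
  nlinarith

theorem one_div_le_tsum {y : ℝ} (hy : 0 < y) : 1 / y ≤ ∑' k : ℕ, 1 / (y + k) ^ 2 := by
  rw [← (hasSum_inv_mul_succ hy).tsum_eq]
  refine (hasSum_inv_mul_succ hy).summable.tsum_le_tsum (fun k => ?_) (summable_one_div_add_sq hy)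
  have : 0 < y + k := by positivity
  rw [div_sub_div _ _ (by positivity) (by positivity), div_le_div_iff₀ (by positivity)
    (by positivity)]
  nlinarith

theorem tsum_le_one_div_add {y : ℝ} (hy : 0 < y) :
    ∑' k : ℕ, 1 / (y + k) ^ 2 ≤ 1 / y + 1 / y ^ 2 := by
  have hs := summable_one_div_add_sq hy
  rw [hs.tsum_eq_zero_add, ← (hasSum_inv_mul_succ hy).tsum_eq]
  have : ∑' k : ℕ, 1 / (y + ((k + 1 : ℕ) : ℝ)) ^ 2 ≤
      ∑' k : ℕ, (1 / (y + k) - 1 / (y + (k + 1))) := by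
    refine ((summable_nat_add_iff 1).2 hs).tsum_le_tsum (fun k => ?_)
      (hasSum_inv_mul_succ hy).summable
    have : 0 < y + k := by positivity
    rw [div_sub_div _ _ (by positivity) (by positivity)]
    push_cast
    rw [div_le_div_iff₀ (by positivity) (by positivity)]
    nlinarith
  simp only [Nat.cast_zero, add_zero]
  linarith

theorem summable_fejerKernel_sub_nat {x : ℝ} (hx : ∀ n : ℤ, x ≠ n) :
    Summable fun k : ℕ => fejerKernel (x - k) := by
  simpa [Function.comp_def] using
    (hasSum_fejerKernel_sub_int hx).summable.comp_injective Nat.cast_injective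

theorem sum_fejerKernel_sub_nat_le_one {x : ℝ} (hx : ∀ n : ℤ, x ≠ n) (n : ℕ) :
    ∑ k ∈ Finset.range n, fejerKernel (x - k) ≤ 1 := by
  simpa using sum_le_hasSum ((Finset.range n).map Nat.castEmbedding)
    (fun _ _ => fejerKernel_nonneg _) (hasSum_fejerKernel_sub_int hx)

theorem fejerKernel_add_nat (x : ℝ) (k : ℕ) :
    fejerKernel (x + k) = Real.sin (Real.pi * x) ^ 2 / Real.pi ^ 2 * (1 / (x + k) ^ 2) := by
  simpa using fejerKernel_sub_int x (-k)

theorem tsum_fejerKernel_add_nat (x : ℝ) :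
    ∑' k : ℕ, fejerKernel (x + k) =
      Real.sin (Real.pi * x) ^ 2 / Real.pi ^ 2 * ∑' k : ℕ, 1 / (x + k) ^ 2 := by
  simp_rw [fejerKernel_add_nat, tsum_mul_left]

theorem Bplus_eq {x : ℝ} (hx : ∀ n : ℤ, x ≠ n) :
    Bplus x = 2 * ∑' k : ℕ, fejerKernel (x - k) +
      2 * (Real.sin (Real.pi * x) ^ 2 / Real.pi ^ 2 * (1 / x)) - 1 := by
  have h : ¬ ∃ n : ℕ, x = n := fun ⟨n, hn⟩ => hx n (by exact_mod_cast hn)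
  have h2 : ∀ k : ℕ, fejerKernel (x - k) =
      Real.sin (Real.pi * x) ^ 2 / Real.pi ^ 2 * (1 / (x - k) ^ 2) := fun k => by
    simpa using fejerKernel_sub_int x k
  rw [Bplus, if_neg h]
  simp_rw [h2, tsum_mul_left]
  ring

theorem Bminus_eq {x : ℝ} (hx : ∀ n : ℤ, x ≠ n) :
    Bminus x = Bplus x - 2 * fejerKernel x := by
  have h : ¬ ∃ n : ℕ, 0 < n ∧ x = n := fun ⟨n, _, hn⟩ => hx n (by exact_mod_cast hn)
  have h2 : ∀ k : ℕ, Real.sin (Real.pi * x) ^ 2 / Real.pi ^ 2 * (1 / (x - (k + 1)) ^ 2) =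
      fejerKernel (x - (k + 1 : ℕ)) := fun k => by
    simpa using (fejerKernel_sub_int x (k + 1)).symm
  rw [Bminus, if_neg h, Bplus_eq hx, (summable_fejerKernel_sub_nat hx).tsum_eq_zero_add]
  simp_rw [← h2, tsum_mul_left]
  simp only [Nat.cast_zero, sub_zero]
  ring

theorem tsum_fejerKernel_sub_nat {x : ℝ} (hx : ∀ n : ℤ, x ≠ n) :
    ∑' k : ℕ, fejerKernel (x - k) = 1 + fejerKernel x - ∑' k : ℕ, fejerKernel (x + k) := by
  have hx' : ∀ n : ℤ, -x ≠ n := fun n hn => hx (-n) (by push_cast; linarith)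
  have hneg : ∀ k : ℕ, fejerKernel (-x - k) = fejerKernel (x + k) := fun k => by
    rw [← fejerKernel_neg, neg_sub, sub_neg_eq_add, add_comm]
  have hs : Summable fun k : ℕ => fejerKernel (x + k) := by
    simpa only [hneg] using summable_fejerKernel_sub_nat hx'
  have h1 := (summable_fejerKernel_sub_nat hx).hasSum
  have h2 := ((summable_nat_add_iff 1).2 hs).hasSum
  have h3 := HasSum.of_nat_of_neg_add_one (f := fun n : ℤ => fejerKernel (x - n))
    (by simpa using h1) (by
      simpa only [Int.cast_neg, Int.cast_add, Int.cast_natCast, Int.cast_one, sub_neg_eq_add,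
        Nat.cast_add, Nat.cast_one] using h2)
  have h4 := h3.unique (hasSum_fejerKernel_sub_int hx)
  rw [hs.tsum_eq_zero_add]
  simp only [Nat.cast_zero, add_zero, Nat.cast_add, Nat.cast_one]
  linarith

theorem abs_sin_sq_mul_one_div_le_one (x : ℝ) :
    |Real.sin (Real.pi * x) ^ 2 / Real.pi ^ 2 * (1 / x)| ≤ 1 := by
  rcases eq_or_ne x 0 with rfl | hx
  · simp
  have hpi := Real.pi_gt_three
  have h : Real.sin (Real.pi * x) ^ 2 / Real.pi ^ 2 * (1 / x) =
      Real.sin (Real.pi * x) / (Real.pi * x) * (Real.sin (Real.pi * x) / Real.pi) := by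
    field_simp
  rw [h, abs_mul, abs_div, abs_div]
  refine mul_le_one₀ (div_le_one_of_le₀ Real.abs_sin_le_abs (abs_nonneg _)) (by positivity)
    (div_le_one_of_le₀ ?_ (abs_nonneg _))
  rw [abs_of_pos Real.pi_pos]
  linarith [Real.abs_sin_le_one (Real.pi * x)]

theorem abs_Bplus_sub_sign_le_fejerKernel {x : ℝ} (hx : ∀ n : ℤ, x ≠ n) :
    |Bplus x - Real.sign x| ≤ 2 * fejerKernel x := by
  have hS : 0 ≤ Real.sin (Real.pi * x) ^ 2 / Real.pi ^ 2 := by positivity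
  have hK : fejerKernel x = Real.sin (Real.pi * x) ^ 2 / Real.pi ^ 2 * (1 / x ^ 2) := by
    simpa using fejerKernel_add_nat x 0
  rcases lt_trichotomy x 0 with h | h | h
  · have hy : 0 < -x := by linarith
    have hneg : ∀ k : ℕ, fejerKernel (x - k) = fejerKernel (-x + k) := fun k => by
      rw [← fejerKernel_neg, neg_sub, sub_eq_neg_add]
    have h1 := mul_le_mul_of_nonneg_left (one_div_le_tsum hy) hS
    have h2 := mul_le_mul_of_nonneg_left (tsum_le_one_div_add hy) hS
    rw [mul_add, neg_sq, ← hK] at h2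
    rw [one_div_neg_eq_neg_one_div] at h1 h2
    rw [Real.sign_of_neg h, Bplus_eq hx]
    simp_rw [hneg]
    rw [tsum_fejerKernel_add_nat, mul_neg, Real.sin_neg, neg_sq, abs_le]
    constructor <;> linarith
  · exact absurd h (by simpa using hx 0)
  · have h1 := mul_le_mul_of_nonneg_left (one_div_le_tsum h) hS
    have h2 := mul_le_mul_of_nonneg_left (tsum_le_one_div_add h) hS
    rw [mul_add, ← hK] at h2
    rw [Real.sign_of_pos h, Bplus_eq hx, tsum_fejerKernel_sub_nat hx, tsum_fejerKernel_add_nat,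
      abs_le]
    constructor <;> linarith

theorem ae_ne_int : ∀ᵐ x : ℝ, ∀ n : ℤ, x ≠ n :=
  ae_all_iff.2 fun n => Measure.ae_ne volume (n : ℝ)

theorem integrable_fejerKernel : Integrable fejerKernel := by
  refine (integrable_inv_one_add_sq.const_mul 2).mono' measurable_fejerKernel.aestronglyMeasurable
    (.of_forall fun x => ?_)
  rw [Real.norm_of_nonneg (fejerKernel_nonneg x), ← div_eq_mul_inv, le_div_iff₀ (by positivity)]
  have h1 := fejerKernel_le_one x
  have h2 : fejerKernel x * x ^ 2 ≤ 1 := by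
    rcases eq_or_ne x 0 with rfl | hx
    · simp
    · exact (le_div_iff₀ (by positivity)).1 (fejerKernel_le_one_div_sq x)
  linarith

/-- A bounded measurable function whose spectrum, as a tempered distribution, lies in
`[-2π, 2π]`: it is orthogonal to every integrable function whose Fourier transform vanishes
on that interval. -/
structure IsBandlimited (f : ℝ → ℝ) : Prop where
  aestronglyMeasurable : AEStronglyMeasurable f
  bounded : ∃ C, ∀ᵐ x, |f x| ≤ C
  integral_eq_zero : ∀ g : ℝ → ℂ, Integrable g →
    (∀ u : ℝ, |u| ≤ 2 * Real.pi → ∫ x, g x * Complex.exp (Complex.I * u * x) = 0) →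
    ∫ x, (f x : ℂ) * g x = 0

namespace IsBandlimited

variable {f h : ℝ → ℝ}

theorem integrable_mul (hf : IsBandlimited f) {g : ℝ → ℂ} (hg : Integrable g) :
    Integrable fun x => (f x : ℂ) * g x := by
  obtain ⟨C, hC⟩ := hf.bounded
  refine hg.bdd_mul (c := C)
    (Complex.continuous_ofReal.comp_aestronglyMeasurable hf.aestronglyMeasurable) ?_
  filter_upwards [hC] with x hx
  simpa using hx

theorem congr (hf : IsBandlimited f) (hfh : f =ᵐ[volume] h) : IsBandlimited h where
  aestronglyMeasurable := hf.aestronglyMeasurable.congr hfh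
  bounded := by
    obtain ⟨C, hC⟩ := hf.bounded
    refine ⟨C, ?_⟩
    filter_upwards [hC, hfh] with x hx hx'
    rwa [← hx']
  integral_eq_zero g hg hg0 := by
    rw [← hf.integral_eq_zero g hg hg0]
    refine integral_congr_ae ?_
    filter_upwards [hfh] with x hx
    rw [hx]

theorem add (hf : IsBandlimited f) (hh : IsBandlimited h) :
    IsBandlimited fun x => f x + h x where
  aestronglyMeasurable := hf.aestronglyMeasurable.add hh.aestronglyMeasurable
  bounded := by
    obtain ⟨C, hC⟩ := hf.bounded
    obtain ⟨D, hD⟩ := hh.bounded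
    refine ⟨C + D, ?_⟩
    filter_upwards [hC, hD] with x hx hx'
    exact (abs_add_le _ _).trans (add_le_add hx hx')
  integral_eq_zero g hg hg0 := by
    simp_rw [Complex.ofReal_add, add_mul]
    rw [integral_add (hf.integrable_mul hg) (hh.integrable_mul hg), hf.integral_eq_zero g hg hg0,
      hh.integral_eq_zero g hg hg0, add_zero]

theorem const_mul (c : ℝ) (hf : IsBandlimited f) : IsBandlimited fun x => c * f x where
  aestronglyMeasurable := hf.aestronglyMeasurable.const_mul c
  bounded := by
    obtain ⟨C, hC⟩ := hf.bounded
    refine ⟨|c| * C, ?_⟩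
    filter_upwards [hC] with x hx
    rw [abs_mul]
    gcongr
  integral_eq_zero g hg hg0 := by
    simp_rw [Complex.ofReal_mul, mul_assoc]
    rw [integral_const_mul, hf.integral_eq_zero g hg hg0, mul_zero]

theorem const (c : ℝ) : IsBandlimited fun _ => c where
  aestronglyMeasurable := aestronglyMeasurable_const
  bounded := ⟨|c|, .of_forall fun _ => le_rfl⟩
  integral_eq_zero g hg hg0 := by
    rw [integral_const_mul]
    have := hg0 0 (by simpa using Real.pi_nonneg)
    simp only [Complex.ofReal_zero, mul_zero, zero_mul, Complex.exp_zero, mul_one] at this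
    rw [this, mul_zero]

theorem sum {ι : Type*} (s : Finset ι) {F : ι → ℝ → ℝ} (hF : ∀ i, IsBandlimited (F i)) :
    IsBandlimited fun x => ∑ i ∈ s, F i x := by
  classical
  induction s using Finset.induction_on with
  | empty => simpa using const 0
  | insert i s hi ih => simpa only [Finset.sum_insert hi] using (hF i).add ih

theorem comp_add_left (hf : IsBandlimited f) (a : ℝ) : IsBandlimited fun x => f (a + x) where
  aestronglyMeasurable := hf.aestronglyMeasurable.comp_measurePreserving
    (measurePreserving_add_left volume a)
  bounded := by
    obtain ⟨C, hC⟩ := hf.bounded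
    exact ⟨C, (measurePreserving_add_left volume a).quasiMeasurePreserving.ae hC⟩
  integral_eq_zero g hg hg0 := by
    have h1 := hf.integral_eq_zero (fun x => g (x - a)) (hg.comp_sub_right a) fun u hu => by
      have h2 := integral_sub_right_eq_self
        (fun x : ℝ => g x * Complex.exp (Complex.I * u * (x + a : ℝ))) a (μ := volume)
      simp only [sub_add_cancel] at h2
      rw [h2]
      simp_rw [Complex.ofReal_add, mul_add, Complex.exp_add, ← mul_assoc]
      rw [integral_mul_const, hg0 u hu, zero_mul]
    rw [← h1, ← integral_add_left_eq_self (fun x : ℝ => (f x : ℂ) * g (x - a)) a]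
    simp

theorem comp_neg (hf : IsBandlimited f) : IsBandlimited fun x => f (-x) where
  aestronglyMeasurable := hf.aestronglyMeasurable.comp_measurePreserving
    (Measure.measurePreserving_neg volume)
  bounded := by
    obtain ⟨C, hC⟩ := hf.bounded
    exact ⟨C, (Measure.measurePreserving_neg volume).quasiMeasurePreserving.ae hC⟩
  integral_eq_zero g hg hg0 := by
    have h1 := hf.integral_eq_zero (fun x => g (-x)) hg.comp_neg fun u hu => by
      rw [← hg0 (-u) (by rwa [abs_neg]), ← integral_neg_eq_self]
      simp
    rw [← h1, ← integral_neg_eq_self]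
    simp

theorem comp_sub_left (hf : IsBandlimited f) (a : ℝ) : IsBandlimited fun x => f (a - x) := by
  simpa [sub_eq_add_neg] using (hf.comp_add_left a).comp_neg

theorem comp_sub_right (hf : IsBandlimited f) (a : ℝ) : IsBandlimited fun x => f (x - a) := by
  simpa [sub_eq_neg_add] using hf.comp_add_left (-a)

theorem of_tendsto {F : ℕ → ℝ → ℝ} (hF : ∀ n, IsBandlimited (F n)) {C : ℝ}
    (hC : ∀ᵐ x, ∀ n, |F n x| ≤ C)
    (hlim : ∀ᵐ x, Tendsto (fun n => F n x) atTop (𝓝 (f x))) : IsBandlimited f where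
  aestronglyMeasurable :=
    aestronglyMeasurable_of_tendsto_ae atTop (fun n => (hF n).aestronglyMeasurable) hlim
  bounded := by
    refine ⟨C, ?_⟩
    filter_upwards [hC, hlim] with x hx hx'
    exact le_of_tendsto hx'.abs (.of_forall hx)
  integral_eq_zero g hg hg0 := by
    have h1 := tendsto_integral_of_dominated_convergence
      (F := fun n x => (F n x : ℂ) * g x) (f := fun x => (f x : ℂ) * g x)
      (fun x => C * ‖g x‖) (fun n => ((hF n).integrable_mul hg).aestronglyMeasurable)
      (hg.norm.const_mul C) (fun n => by
        filter_upwards [hC] with x hx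
        rw [norm_mul, Complex.norm_real, Real.norm_eq_abs]
        exact mul_le_mul_of_nonneg_right (hx n) (norm_nonneg _)) (by
        filter_upwards [hlim] with x hx
        exact ((Complex.continuous_ofReal.tendsto _).comp hx).mul_const _)
    simp_rw [(hF _).integral_eq_zero g hg hg0] at h1
    exact tendsto_nhds_unique h1 tendsto_const_nhds |>.symm ▸ rfl

theorem cos {u : ℝ} (hu : |u| ≤ 2 * Real.pi) : IsBandlimited fun x => Real.cos (u * x) where
  aestronglyMeasurable := by fun_prop
  bounded := ⟨1, .of_forall fun x => Real.abs_cos_le_one _⟩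
  integral_eq_zero g hg hg0 := by
    have hi : ∀ v : ℝ, Integrable fun x : ℝ => g x * Complex.exp (Complex.I * v * x) := fun v =>
      hg.mul_bdd (c := 1) (by fun_prop) (.of_forall fun x => by
        rw [mul_assoc, ← Complex.ofReal_mul, mul_comm, Complex.norm_exp_ofReal_mul_I])
    have : ∀ x : ℝ, (Real.cos (u * x) : ℂ) * g x =
        (g x * Complex.exp (Complex.I * u * x) +
          g x * Complex.exp (Complex.I * (-u : ℝ) * x)) / 2 := fun x => by
      rw [Complex.ofReal_cos, Complex.cos]
      push_cast
      ring_nf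
    simp_rw [this]
    rw [integral_div, integral_add (hi _) (hi _), hg0 u hu, hg0 (-u) (by rwa [abs_neg])]
    simp

theorem sin {u : ℝ} (hu : |u| ≤ 2 * Real.pi) : IsBandlimited fun x => Real.sin (u * x) where
  aestronglyMeasurable := by fun_prop
  bounded := ⟨1, .of_forall fun x => Real.abs_sin_le_one _⟩
  integral_eq_zero g hg hg0 := by
    have hi : ∀ v : ℝ, Integrable fun x : ℝ => g x * Complex.exp (Complex.I * v * x) := fun v =>
      hg.mul_bdd (c := 1) (by fun_prop) (.of_forall fun x => by
        rw [mul_assoc, ← Complex.ofReal_mul, mul_comm, Complex.norm_exp_ofReal_mul_I])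
    have : ∀ x : ℝ, (Real.sin (u * x) : ℂ) * g x =
        (g x * Complex.exp (Complex.I * (-u : ℝ) * x) -
          g x * Complex.exp (Complex.I * u * x)) * (Complex.I / 2) := fun x => by
      rw [Complex.ofReal_sin, Complex.sin]
      push_cast
      ring_nf
    simp_rw [this]
    rw [integral_mul_const, integral_sub (hi _) (hi _), hg0 u hu, hg0 (-u) (by rwa [abs_neg])]
    simp

theorem integral_param {F : ℝ → ℝ → ℝ} (hF : Continuous (Function.uncurry F)) {C : ℝ}
    (hC : ∀ u ∈ Set.Ioc 0 (2 * Real.pi), ∀ x, |F u x| ≤ C)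
    (hb : ∀ u ∈ Set.Ioc 0 (2 * Real.pi), IsBandlimited (F u)) :
    IsBandlimited fun x => ∫ u in Set.Ioc 0 (2 * Real.pi), F u x where
  aestronglyMeasurable :=
    hF.stronglyMeasurable.integral_prod_left.aestronglyMeasurable
  bounded := by
    refine ⟨C * volume.real (Set.Ioc 0 (2 * Real.pi)), .of_forall fun x => ?_⟩
    rw [← Real.norm_eq_abs]
    exact norm_setIntegral_le_of_norm_le_const measure_Ioc_lt_top fun u hu => hC u hu x
  integral_eq_zero g hg hg0 := by
    have hint : Integrable (Function.uncurry fun (x u : ℝ) => (F u x : ℂ) * g x)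
        (volume.prod (volume.restrict (Set.Ioc 0 (2 * Real.pi)))) := by
      refine (hg.comp_fst (volume.restrict (Set.Ioc 0 (2 * Real.pi)))).bdd_mul (c := C)
        (Complex.continuous_ofReal.comp (hF.comp continuous_swap)).aestronglyMeasurable ?_
      have : ∀ᵐ p : ℝ × ℝ ∂(volume.prod (volume.restrict (Set.Ioc 0 (2 * Real.pi)))),
          p.2 ∈ Set.Ioc 0 (2 * Real.pi) :=
        Measure.quasiMeasurePreserving_snd.ae (ae_restrict_mem measurableSet_Ioc)
      filter_upwards [this] with p hp
      simpa using hC p.2 hp p.1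
    simp_rw [← integral_complex_ofReal, ← integral_mul_const]
    rw [integral_integral_swap hint]
    refine integral_eq_zero_of_ae ?_
    filter_upwards [ae_restrict_mem measurableSet_Ioc] with u hu
    exact (hb u hu).integral_eq_zero g hg hg0

end IsBandlimited

theorem isBandlimited_fejerKernel : IsBandlimited fejerKernel := by
  have hb : IsBandlimited fun x => ∫ u in Set.Ioc 0 (2 * Real.pi),
      (2 * Real.pi - u) * Real.cos (u * x) := by
    refine IsBandlimited.integral_param (C := 2 * Real.pi) (by fun_prop) (fun u hu x => ?_)
      fun u hu => (IsBandlimited.cos (by rw [abs_of_pos hu.1]; exact hu.2)).const_mul _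
    rw [abs_mul, abs_of_nonneg (sub_nonneg.2 hu.2)]
    have h1 := Real.abs_cos_le_one (u * x)
    have h2 := hu.1
    have h3 := hu.2
    nlinarith [abs_nonneg (Real.cos (u * x))]
  refine (hb.const_mul (1 / (2 * Real.pi ^ 2))).congr ?_
  filter_upwards [Measure.ae_ne volume (0 : ℝ)] with x hx
  have hd : ∀ u ∈ Set.uIcc 0 (2 * Real.pi), HasDerivAt
      (fun u : ℝ => (2 * Real.pi - u) * (Real.sin (u * x) / x) - Real.cos (u * x) / x ^ 2)
      ((2 * Real.pi - u) * Real.cos (u * x)) u := fun u _ => by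
    have hu : HasDerivAt (fun u : ℝ => u * x) x u := by simpa using (hasDerivAt_id u).mul_const x
    refine ((((hasDerivAt_id' u).const_sub (2 * Real.pi)).mul (hu.sin.div_const x)).sub
      (hu.cos.div_const (x ^ 2))).congr_deriv ?_
    field_simp
    ring
  rw [← intervalIntegral.integral_of_le (by positivity),
    intervalIntegral.integral_eq_sub_of_hasDerivAt hd
      (Continuous.intervalIntegrable (by fun_prop) _ _), fejerKernel, div_pow,
    Real.sin_sq_eq_half_sub]
  rw [← mul_assoc 2 Real.pi x]
  have := Real.pi_ne_zero
  simp only [sub_self, zero_mul, Real.cos_zero, Real.sin_zero]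
  field_simp
  ring

theorem isBandlimited_sin_sq_mul_one_div :
    IsBandlimited fun x => Real.sin (Real.pi * x) ^ 2 / Real.pi ^ 2 * (1 / x) := by
  have hb : IsBandlimited fun x => ∫ u in Set.Ioc 0 (2 * Real.pi), Real.sin (u * x) :=
    IsBandlimited.integral_param (C := 1) (by fun_prop) (fun u _ x => Real.abs_sin_le_one _)
      fun u hu => IsBandlimited.sin (by rw [abs_of_pos hu.1]; exact hu.2)
  refine (hb.const_mul (1 / (2 * Real.pi ^ 2))).congr ?_
  filter_upwards [Measure.ae_ne volume (0 : ℝ)] with x hx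
  have hd : ∀ u ∈ Set.uIcc 0 (2 * Real.pi), HasDerivAt
      (fun u : ℝ => -(Real.cos (u * x) / x)) (Real.sin (u * x)) u := fun u _ => by
    have hu : HasDerivAt (fun u : ℝ => u * x) x u := by simpa using (hasDerivAt_id u).mul_const x
    refine (hu.cos.div_const x).neg.congr_deriv ?_
    rw [neg_mul, neg_div, neg_neg, mul_div_cancel_right₀ _ hx]
  rw [← intervalIntegral.integral_of_le (by positivity),
    intervalIntegral.integral_eq_sub_of_hasDerivAt hd
      (Continuous.intervalIntegrable (by fun_prop) _ _), Real.sin_sq_eq_half_sub]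
  rw [← mul_assoc 2 Real.pi x]
  have := Real.pi_ne_zero
  simp only [zero_mul, Real.cos_zero]
  field_simp
  ring

theorem isBandlimited_Bplus : IsBandlimited Bplus := by
  refine IsBandlimited.of_tendsto (C := 5) (F := fun n x =>
    2 * ∑ k ∈ Finset.range n, fejerKernel (x - k) +
      2 * (Real.sin (Real.pi * x) ^ 2 / Real.pi ^ 2 * (1 / x)) + -1)
    (fun n => ?_) ?_ ?_
  · exact (((IsBandlimited.sum _ fun k : ℕ =>
      isBandlimited_fejerKernel.comp_sub_right k).const_mul 2).add
        (isBandlimited_sin_sq_mul_one_div.const_mul 2)).add (IsBandlimited.const (-1))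
  · filter_upwards [ae_ne_int] with x hx n
    have h1 := sum_fejerKernel_sub_nat_le_one hx n
    have h2 : 0 ≤ ∑ k ∈ Finset.range n, fejerKernel (x - k) :=
      Finset.sum_nonneg fun k _ => fejerKernel_nonneg _
    have h3 := abs_le.1 (abs_sin_sq_mul_one_div_le_one x)
    rw [abs_le]
    constructor <;> linarith [h3.1, h3.2]
  · filter_upwards [ae_ne_int] with x hx
    rw [Bplus_eq hx, sub_eq_add_neg]
    exact (((summable_fejerKernel_sub_nat hx).hasSum.tendsto_sum_nat.const_mul 2).add_const
      _).add_const _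

theorem Bminus_ae_eq : Bminus =ᵐ[volume] fun x => Bplus x + -2 * fejerKernel x := by
  filter_upwards [ae_ne_int] with x hx
  rw [Bminus_eq hx]
  ring

theorem isBandlimited_Bminus : IsBandlimited Bminus :=
  (isBandlimited_Bplus.add (isBandlimited_fejerKernel.const_mul (-2))).congr Bminus_ae_eq.symm

theorem measurable_real_sign : Measurable Real.sign := by
  unfold Real.sign
  exact Measurable.ite measurableSet_Iio measurable_const
    (Measurable.ite measurableSet_Ioi measurable_const measurable_const)

theorem integrable_Bplus_sub_sign : Integrable fun x => Bplus x - Real.sign x := by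
  refine (integrable_fejerKernel.const_mul 2).mono' (isBandlimited_Bplus.aestronglyMeasurable.sub
    measurable_real_sign.aestronglyMeasurable) ?_
  filter_upwards [ae_ne_int] with x hx
  exact abs_Bplus_sub_sign_le_fejerKernel hx

theorem integrable_Bminus_sub_sign : Integrable fun x => Bminus x - Real.sign x := by
  refine (integrable_Bplus_sub_sign.add (integrable_fejerKernel.const_mul (-2))).congr ?_
  filter_upwards [Bminus_ae_eq] with x hx
  rw [hx, Pi.add_apply]
  ring

theorem integrable_sign_add_sign (δ : ℝ) :
    Integrable fun x => Real.sign (δ + x) + Real.sign (δ - x) := by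
  have hm : Measurable fun x => Real.sign (δ + x) + Real.sign (δ - x) :=
    (measurable_real_sign.comp (measurable_const_add δ)).add
      (measurable_real_sign.comp (measurable_const_sub δ))
  have hi : Integrable (Set.indicator (Set.Icc (-|δ|) |δ|) fun _ : ℝ => (2 : ℝ)) :=
    (integrable_indicator_iff measurableSet_Icc).2 (integrableOn_const measure_Icc_lt_top.ne)
  refine hi.mono' hm.aestronglyMeasurable (.of_forall fun x => ?_)
  by_cases hx : x ∈ Set.Icc (-|δ|) |δ|
  · rw [Set.indicator_of_mem hx]
    refine (norm_add_le _ _).trans ?_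
    have : ∀ y, ‖Real.sign y‖ ≤ 1 := fun y => by
      rcases Real.sign_apply_eq y with h | h | h <;> simp [h]
    linarith [this (δ + x), this (δ - x)]
  · rw [Set.indicator_of_notMem hx]
    rw [Set.mem_Icc, ← abs_le, not_le, lt_abs] at hx
    rcases hx with h | h
    · rw [Real.sign_of_pos (by linarith [neg_abs_le δ]),
        Real.sign_of_neg (by linarith [le_abs_self δ])]
      simp
    · rw [Real.sign_of_neg (by linarith [le_abs_self δ]),
        Real.sign_of_pos (by linarith [neg_abs_le δ])]
      simp

theorem integrable_symmetrization {B : ℝ → ℝ} (hB : Integrable fun x => B x - Real.sign x)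
    (δ : ℝ) : Integrable fun x => B (δ + x) / 2 + B (δ - x) / 2 := by
  refine (((hB.comp_add_left δ).add (hB.comp_sub_left δ)).add
    (integrable_sign_add_sign δ) |>.div_const 2).congr (.of_forall fun x => ?_)
  simp only [Pi.add_apply]
  ring

theorem IsBandlimited.symmetrization {B : ℝ → ℝ} (hB : IsBandlimited B) (δ : ℝ) :
    IsBandlimited fun x => B (δ + x) / 2 + B (δ - x) / 2 := by
  simpa only [div_eq_inv_mul] using
    ((hB.comp_add_left δ).const_mul 2⁻¹).add ((hB.comp_sub_left δ).const_mul 2⁻¹)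

open scoped FourierTransform in
/-- There is an integrable bounded continuous function taking the value `1` at the origin whose
Fourier transform is compactly supported. -/
theorem exists_integrable_fourier_compactSupport :
    ∃ r : ℝ → ℂ, Continuous r ∧ Integrable r ∧ (∃ C, ∀ x, ‖r x‖ ≤ C) ∧ r 0 = 1 ∧
      ∀ s : ℝ, 4 * Real.pi ≤ |s| → ∫ x, r x * Complex.exp (Complex.I * s * x) = 0 := by
  let b : ContDiffBump (0 : ℝ) := ⟨1, 2, one_pos, one_lt_two⟩
  have hc : HasCompactSupport fun x : ℝ => (b.normed volume x : ℂ) :=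
    b.hasCompactSupport_normed.comp_left Complex.ofReal_zero
  have hd : ContDiff ℝ (⊤ : ℕ∞) fun x : ℝ => (b.normed volume x : ℂ) :=
    Complex.ofRealCLM.contDiff.comp b.contDiff_normed
  let h : SchwartzMap ℝ ℂ := hc.toSchwartzMap hd
  have hh : ∀ x, h x = (b.normed volume x : ℂ) := fun x => rfl
  let r : SchwartzMap ℝ ℂ := 𝓕 h
  refine ⟨r, r.continuous, r.integrable, ?_, ?_, fun s hs => ?_⟩
  · obtain ⟨C, hC⟩ := r.decay 0 0
    exact ⟨C, fun x => by simpa using hC.2 x⟩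
  · change (𝓕 h) 0 = 1
    rw [SchwartzMap.fourier_coe, Real.fourier_real_eq_integral_exp_smul]
    simp only [hh, mul_zero, Complex.ofReal_zero, zero_mul, Complex.exp_zero, one_smul]
    rw [integral_complex_ofReal, b.integral_normed, Complex.ofReal_one]
  · have h1 : (𝓕⁻ r) (s / (2 * Real.pi)) = h (s / (2 * Real.pi)) := by
      rw [FourierTransform.fourierInv_fourier_eq]
    have h2 : h (s / (2 * Real.pi)) = 0 := by
      rw [hh, Complex.ofReal_eq_zero, ← Function.notMem_support, b.support_normed_eq]
      rw [Metric.mem_ball, dist_zero_right, not_lt, Real.norm_eq_abs, abs_div,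
        abs_of_pos Real.two_pi_pos, le_div_iff₀ Real.two_pi_pos]
      change 2 * (2 * Real.pi) ≤ |s|
      linarith
    rw [h2, SchwartzMap.fourierInv_coe, Real.fourierInv_eq'] at h1
    rw [← h1]
    refine integral_congr_ae (.of_forall fun x => ?_)
    have := Real.pi_ne_zero
    have h3 : 2 * Real.pi * inner ℝ x (s / (2 * Real.pi)) = s * x := by
      simp only [RCLike.inner_apply, conj_trivial]
      field_simp
    simp only [smul_eq_mul]
    rw [h3, mul_comm]
    congr 2
    push_cast
    ring

theorem IsBandlimited.fourier_eq_zero {f : ℝ → ℝ} (hf : IsBandlimited f) (hi : Integrable f)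
    {t : ℝ} (ht : 2 * Real.pi < |t|) :
    ∫ x : ℝ, (f x : ℂ) * Complex.exp (-(Complex.I * (t : ℂ) * (x : ℂ))) = 0 := by
  obtain ⟨r, hrc, hri, ⟨C, hC⟩, hr0, hr⟩ := exists_integrable_fourier_compactSupport
  have hnorm : ∀ x : ℝ, ‖Complex.exp (-(Complex.I * (t : ℂ) * (x : ℂ)))‖ = 1 := fun x => by
    rw [show -(Complex.I * (t : ℂ) * (x : ℂ)) = ((-(t * x) : ℝ) : ℂ) * Complex.I by
      push_cast; ring, Complex.norm_exp_ofReal_mul_I]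
  have hpi := Real.pi_pos
  have hzero : ∀ ε : ℝ, 0 < ε → ε * (4 * Real.pi) ≤ |t| - 2 * Real.pi →
      ∫ x : ℝ, (f x : ℂ) * (r (ε * x) * Complex.exp (-(Complex.I * (t : ℂ) * (x : ℂ)))) = 0 := by
    intro ε hε hεt
    refine hf.integral_eq_zero _ ((hri.comp_mul_left' hε.ne').mul_bdd (c := 1) (by fun_prop)
      (.of_forall fun x => (hnorm x).le)) fun u hu => ?_
    have h1 := Measure.integral_comp_mul_left
      (fun y : ℝ => r y * Complex.exp (Complex.I * ((u - t) / ε : ℝ) * y)) ε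
    rw [hr, smul_zero] at h1
    · rw [← h1]
      refine integral_congr_ae (.of_forall fun x => ?_)
      have hε' : (ε : ℂ) ≠ 0 := Complex.ofReal_ne_zero.2 hε.ne'
      simp only [mul_assoc, ← Complex.exp_add]
      congr 2
      push_cast
      field_simp
      ring
    · rw [abs_div, abs_of_pos hε, le_div_iff₀ hε]
      have := abs_sub_abs_le_abs_sub t u
      rw [abs_sub_comm] at this
      linarith
  let ε : ℕ → ℝ := fun n => (|t| - 2 * Real.pi) / (4 * Real.pi) * (1 / ((n : ℝ) + 1))
  have hε : Tendsto ε atTop (𝓝 0) := by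
    simpa only [mul_zero] using tendsto_one_div_add_atTop_nhds_zero_nat.const_mul
      ((|t| - 2 * Real.pi) / (4 * Real.pi))
  have hε0 : ∀ n, ∫ x : ℝ, (f x : ℂ) *
      (r (ε n * x) * Complex.exp (-(Complex.I * (t : ℂ) * (x : ℂ)))) = 0 := fun n => by
    have hp : 0 < |t| - 2 * Real.pi := by linarith
    refine hzero _ (by positivity) ?_
    have h1 : 1 / ((n : ℝ) + 1) ≤ 1 := div_le_one_of_le₀ (by linarith [n.cast_nonneg (α := ℝ)])
      (by positivity)
    calc ε n * (4 * Real.pi) = (|t| - 2 * Real.pi) * (1 / ((n : ℝ) + 1)) := by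
          simp only [ε]
          field_simp
      _ ≤ _ := mul_le_of_le_one_right hp.le h1
  have hlim := tendsto_integral_of_dominated_convergence
    (F := fun n (x : ℝ) => (f x : ℂ) *
      (r (ε n * x) * Complex.exp (-(Complex.I * (t : ℂ) * (x : ℂ)))))
    (f := fun x : ℝ => (f x : ℂ) * Complex.exp (-(Complex.I * (t : ℂ) * (x : ℂ))))
    (μ := volume) (fun x => ‖f x‖ * C)
    (fun n => (Complex.continuous_ofReal.comp_aestronglyMeasurable hi.aestronglyMeasurable).mul
      (Continuous.aestronglyMeasurable (by fun_prop)))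
    (hi.norm.mul_const C) (fun n => .of_forall fun x => by
      rw [norm_mul, norm_mul, hnorm, mul_one, Complex.norm_real]
      exact mul_le_mul_of_nonneg_left (hC _) (norm_nonneg _))
    (.of_forall fun x => by
      have h1 : Tendsto (fun n => r (ε n * x)) atTop (𝓝 1) := by
        rw [← hr0]
        refine (hrc.tendsto 0).comp ?_
        simpa using hε.mul_const x
      simpa using (h1.mul_const _).const_mul (f x : ℂ))
  simp_rw [hε0] at hlim
  exact tendsto_nhds_unique hlim tendsto_const_nhds

end Bandlimited

/-- The Beurling–Selberg majorant/minorant `φ₊`, `φ₋` are Lebesgue integrable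
and band-limited: their Fourier transforms `φ̂±(t) = ∫ φ±(x) e^{-itx} dx` vanish for
`|t| > 2π`. -/
theorem phiPlus_phiMinus_bandlimited (δ : ℝ) (hδ : 0 < δ) :
    MeasureTheory.Integrable (phiPlus δ) ∧
    MeasureTheory.Integrable (phiMinus δ) ∧
    (∀ t : ℝ, 2 * Real.pi < |t| →
      (∫ x : ℝ, (phiPlus δ x : ℂ) * Complex.exp (-(Complex.I * (t : ℂ) * (x : ℂ)))) = 0) ∧
    (∀ t : ℝ, 2 * Real.pi < |t| →
      (∫ x : ℝ, (phiMinus δ x : ℂ) * Complex.exp (-(Complex.I * (t : ℂ) * (x : ℂ)))) = 0) := by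
  have hp := integrable_symmetrization integrable_Bplus_sub_sign δ
  have hm := integrable_symmetrization integrable_Bminus_sub_sign δ
  exact ⟨hp, hm, fun t ht => (isBandlimited_Bplus.symmetrization δ).fourier_eq_zero hp ht,
    fun t ht => (isBandlimited_Bminus.symmetrization δ).fourier_eq_zero hm ht⟩
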